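/- Suppose ≻_s is a partial order (asymmetric and transitive) for every s ∈ S, and μ₁, …, μ_K (K ≥ 1) are stable matchings for ≻ such that μ_{k'} Pareto dominates μ_k whenever 1 ≤ k < k' ≤ K. Then there exists an extension profile ≻* of ≻ such that every μ_k (k = 1, …, K) is stable for ≻*. -/

import Mathlib

/-! Common definitions for school choice with partial priorities
(Kitahara–Okumura, "On extensions of partial priorities in school choice"). -/

/-- A binary relation is asymmetric. -/
def Asymm {I : Type*} (B : I → I → Prop) : Prop :=
  ∀ i j, B i j → ¬ B j i

/-- Negative transitivity. -/
def NegTransitive {I : Type*} (B : I → I → Prop) : Prop :=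
  ∀ a b c : I, ¬ B a b → ¬ B b c → ¬ B a c

/-- Acyclicity: there are no `K ≥ 1` and `x₀, …, x_K` with `(x_{k-1}, x_k) ∈ B` for all
`k = 1, …, K` and `(x_K, x₀) ∈ B`. -/
def AcyclicRel {I : Type*} (B : I → I → Prop) : Prop :=
  ¬ ∃ (K : ℕ) (x : ℕ → I), 1 ≤ K ∧ (∀ k, 1 ≤ k → k ≤ K → B (x (k - 1)) (x k)) ∧ B (x K) (x 0)

/-- A (strict) partial order: an asymmetric relation that is transitive. -/
def PartialOrderRel {I : Type*} (B : I → I → Prop) : Prop :=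
  Asymm B ∧ Transitive B

/-- A weak order: a partial order that is negatively transitive. -/
def WeakOrderRel {I : Type*} (B : I → I → Prop) : Prop :=
  PartialOrderRel B ∧ NegTransitive B

/-- A total order: a weak order that is complete. -/
def TotalOrderRel {I : Type*} (B : I → I → Prop) : Prop :=
  WeakOrderRel B ∧ ∀ a b : I, a ≠ b → B a b ∨ B b a

/-- A strict total order preference over `Option S`, where `none` is the outside option `∅`. -/
def StrictPref {S : Type*} (P : Option S → Option S → Prop) : Prop :=
  Asymm P ∧ Transitive P ∧ ∀ a b : Option S, a ≠ b → P a b ∨ P b a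

/-- The weak preference `R` associated with `P`: `a R b` iff `a P b` or `a = b`. -/
def RPref {S : Type*} (P : Option S → Option S → Prop) (a b : Option S) : Prop :=
  P a b ∨ a = b

/-- A matching: an assignment of students to schools (or `none`) respecting capacities. -/
def IsMatching {I S : Type*} [Fintype I] (q : S → ℕ) (μ : I → Option S) : Prop :=
  ∀ s : S, {i : I | μ i = some s}.ncard ≤ q s

/-- Individual rationality: every student weakly prefers her assignment to `∅`. -/
def IndividuallyRational {I S : Type*} (P : I → Option S → Option S → Prop)
    (μ : I → Option S) : Prop :=
  ∀ i, RPref (P i) (μ i) none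

/-- Non-wastefulness: whenever a student strictly prefers `s` to her assignment, `s` is full. -/
def NonWasteful {I S : Type*} [Fintype I] (P : I → Option S → Option S → Prop) (q : S → ℕ)
    (μ : I → Option S) : Prop :=
  ∀ i s, P i (some s) (μ i) → {j : I | μ j = some s}.ncard = q s

/-- Fairness for the priority profile `pr`: no student's priority is violated. -/
def Fair {I S : Type*} (P : I → Option S → Option S → Prop) (pr : S → I → I → Prop)
    (μ : I → Option S) : Prop :=
  ¬ ∃ (i j : I) (s : S), μ j = some s ∧ μ i ≠ some s ∧ RPref (P i) (some s) (μ i) ∧ pr s i j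

/-- Stability for the priority profile `pr`. -/
def StableFor {I S : Type*} [Fintype I] (P : I → Option S → Option S → Prop) (q : S → ℕ)
    (pr : S → I → I → Prop) (μ : I → Option S) : Prop :=
  IndividuallyRational P μ ∧ NonWasteful P q μ ∧ Fair P pr μ

/-- `μ'` Pareto dominates `μ`. -/
def ParetoDominates {I S : Type*} (P : I → Option S → Option S → Prop)
    (μ' μ : I → Option S) : Prop :=
  (∀ i, RPref (P i) (μ' i) (μ i)) ∧ ∃ i, P i (μ' i) (μ i)

/-- A student optimal stable matching (SOSM) for `pr`. -/
def IsSOSM {I S : Type*} [Fintype I] (P : I → Option S → Option S → Prop) (q : S → ℕ)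
    (pr : S → I → I → Prop) (μ : I → Option S) : Prop :=
  StableFor P q pr μ ∧
    ¬ ∃ μ' : I → Option S, IsMatching q μ' ∧ StableFor P q pr μ' ∧ ParetoDominates P μ' μ

/-- `B'` is a total order extension of `B`. -/
def IsExtension {I : Type*} (B B' : I → I → Prop) : Prop :=
  TotalOrderRel B' ∧ ∀ i j, B i j → B' i j

/-- `pr'` is an extension profile of `pr`. -/
def IsExtensionProfile {I S : Type*} (pr pr' : S → I → I → Prop) : Prop :=
  ∀ s, IsExtension (pr s) (pr' s)

/-- The maximal set `M(I', B)` of elements of `I'` undominated within `I'`. -/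
def MaximalSet {I : Type*} (B : I → I → Prop) (I' : Set I) : Set I :=
  {i ∈ I' | ∀ j ∈ I', j ≠ i → ¬ B j i}

/-- `e` enumerates `I` as a sequential maximal ordering (SMO) sequence for `B`:
each element is chosen from the maximal set of the remaining elements. -/
def IsSMOSeq {I : Type*} [Fintype I] (B : I → I → Prop)
    (e : Fin (Fintype.card I) ≃ I) : Prop :=
  ∀ t, e t ∈ MaximalSet B {i | ∀ t' : Fin (Fintype.card I), t' < t → e t' ≠ i}

/-- The total order induced by an enumeration: earlier elements rank higher. -/
def InducedOrder {I : Type*} [Fintype I] (e : Fin (Fintype.card I) ≃ I) : I → I → Prop :=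
  fun i j => e.symm i < e.symm j

/-- `e` is the `r`-tiebreaking SMO sequence for `B`: at each step it picks the element of the
maximal set of the remaining elements minimizing `r`. -/
def IsRTiebreakSMOSeq {I : Type*} [Fintype I] (B : I → I → Prop)
    (r : I ≃ Fin (Fintype.card I)) (e : Fin (Fintype.card I) ≃ I) : Prop :=
  IsSMOSeq B e ∧
    ∀ t, ∀ i ∈ MaximalSet B {i | ∀ t' : Fin (Fintype.card I), t' < t → e t' ≠ i},
      r (e t) ≤ r i

/-- `pr'` is obtained from `pr` by a single (common) tiebreaking rule: one bijection
`r` from `I` to `{1, …, |I|}` such that every `pr' s` is induced by the `r`-tiebreaking SMO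
sequence for `pr s`. -/
def SingleTiebreakProfile {I S : Type*} [Fintype I] (pr pr' : S → I → I → Prop) : Prop :=
  ∃ r : I ≃ Fin (Fintype.card I), ∀ s : S,
    ∃ e : Fin (Fintype.card I) ≃ I, IsRTiebreakSMOSeq (pr s) r e ∧ pr' s = InducedOrder e

/-- Partial stability for `(pr, C)`: individually rational, non-wasteful, and every priority
violation is allowed by `C`. -/
def PartiallyStable {I S : Type*} [Fintype I] (P : I → Option S → Option S → Prop) (q : S → ℕ)
    (pr : S → I → I → Prop) (C : S → I → I → Prop) (μ : I → Option S) : Prop :=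
  IndividuallyRational P μ ∧ NonWasteful P q μ ∧
    ∀ (i j : I) (s : S), μ j = some s → P i (some s) (μ i) → pr s i j → C s i j

/-- Szpilrajn extension theorem for strict orders: every partial order extends to a total
order. -/
theorem PartialOrderRel.exists_isExtension {I : Type*} {B : I → I → Prop}
    (hB : PartialOrderRel B) : ∃ B' : I → I → Prop, IsExtension B B' := by
  obtain ⟨hasymm, htrans⟩ := hB
  have hpo : IsPartialOrder I fun a b => a = b ∨ B a b :=
    { refl := fun a => Or.inl rfl
      trans := by
        rintro a b c (rfl | hab) (rfl | hbc)
        · exact Or.inl rfl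
        · exact Or.inr hbc
        · exact Or.inr hab
        · exact Or.inr (htrans hab hbc)
      antisymm := by
        rintro a b (rfl | hab) (h | hba)
        · rfl
        · rfl
        · exact h.symm
        · exact absurd hba (hasymm a b hab) }
  obtain ⟨L, hL, hle⟩ := extend_partialOrder fun a b => a = b ∨ B a b
  have hanti : ∀ a b, L a b → L b a → a = b := fun a b => hL.antisymm a b
  have htransL : ∀ a b c, L a b → L b c → L a c := fun a b c => hL.trans a b c
  have htotal : ∀ a b, L a b ∨ L b a := fun a b => hL.total a b
  have hBL : ∀ a b, B a b → L a b := fun a b h => hle a b (Or.inr h)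
  have hirr : ∀ a, ¬ B a a := fun a h => hasymm a a h h
  refine ⟨fun a b => L a b ∧ a ≠ b, ⟨⟨⟨⟨?_, ?_⟩, ?_⟩, ?_⟩, ?_⟩⟩
  · exact fun a b hab hba => hab.2 (hanti a b hab.1 hba.1)
  · refine fun a b c hab hbc => ⟨htransL a b c hab.1 hbc.1, ?_⟩
    rintro rfl
    exact hab.2 (hanti a b hab.1 hbc.1)
  · rintro a b c hab hbc ⟨hac, hne⟩
    have hba : L b a := by
      by_cases h : a = b
      · exact h ▸ (htotal a a).elim id id
      · exact (htotal a b).resolve_left fun h' => hab ⟨h', h⟩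
    have hcb : L c b := by
      by_cases h : b = c
      · exact h ▸ (htotal b b).elim id id
      · exact (htotal b c).resolve_left fun h' => hbc ⟨h', h⟩
    exact hne (hanti a c hac (htransL c b a hcb hba))
  · exact fun a b hne => (htotal a b).imp (fun h => ⟨h, hne⟩) fun h => ⟨h, hne.symm⟩
  · refine fun a b hab => ⟨hBL a b hab, ?_⟩
    rintro rfl
    exact hirr a hab

/-- Let `A k` be the set of occupants and `E k` the set of envious agents at stage `k`. If the
envious sets shrink over time, nobody is at once an occupant and envious, and no envious agent
has priority over an occupant, then the partial order `B` has a total order extension that ranks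
every occupant above every envious agent of the same stage. -/
theorem PartialOrderRel.exists_isExtension_above {I κ : Type*} [LinearOrder κ]
    {B : I → I → Prop} (hB : PartialOrderRel B) {A E : κ → I → Prop}
    (hE : ∀ k k' i, k ≤ k' → E k' i → E k i) (hAE : ∀ k i, A k i → ¬ E k i)
    (hfair : ∀ k i j, A k j → E k i → ¬ B i j) :
    ∃ B' : I → I → Prop, IsExtension B B' ∧ ∀ k i j, A k j → E k i → B' j i := by
  obtain ⟨hasymm, htrans⟩ := hB
  have htr : ∀ {a b c}, (a = b ∨ B a b) → (b = c ∨ B b c) → (a = c ∨ B a c) := by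
    rintro a b c (rfl | hab) (rfl | hbc)
    · exact Or.inl rfl
    · exact Or.inr hbc
    · exact Or.inr hab
    · exact Or.inr (htrans hab hbc)
  have hlt : ∀ {k k' i j}, E k i → (i = j ∨ B i j) → A k' j → k < k' := by
    intro k k' i j hi hij hj
    by_contra! hkk
    have hi' := hE k' k i hkk hi
    rcases hij with rfl | hij
    · exact hAE k' i hj hi'
    · exact hfair k' i j hj hi' hij
  let T : I → I → Prop := fun x y =>
    ∃ k j i, (x = j ∨ B x j) ∧ A k j ∧ E k i ∧ (i = y ∨ B i y)
  have hTirr : ∀ x, ¬ T x x := fun x ⟨k, j, i, hxj, hj, hi, hix⟩ =>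
    lt_irrefl k (hlt hi (htr hix hxj) hj)
  have hTtrans : ∀ x y z, T x y → T y z → T x z :=
    fun x y z ⟨k, j, i, hxj, hj, hi, hiy⟩ ⟨k', j', i', hyj', hj', hi', hiz⟩ =>
      ⟨k, j, i', hxj, hj, hE k k' i' (hlt hi (htr hiy hyj') hj').le hi', hiz⟩
  have hBT : ∀ x y z, B x y → T y z → T x z := fun x y z hxy ⟨k, j, i, hyj, hj, hi, hiz⟩ =>
    ⟨k, j, i, htr (Or.inr hxy) hyj, hj, hi, hiz⟩
  have hTB : ∀ x y z, T x y → B y z → T x z := fun x y z ⟨k, j, i, hxj, hj, hi, hiy⟩ hyz =>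
    ⟨k, j, i, hxj, hj, hi, htr hiy (Or.inr hyz)⟩
  have hU : PartialOrderRel fun x y => B x y ∨ T x y := by
    constructor
    · rintro x y (hxy | hxy) (hyx | hyx)
      · exact hasymm x y hxy hyx
      · exact hTirr x (hBT x y x hxy hyx)
      · exact hTirr x (hTB x y x hxy hyx)
      · exact hTirr x (hTtrans x y x hxy hyx)
    · rintro x y z (hxy | hxy) (hyz | hyz)
      · exact Or.inl (htrans hxy hyz)
      · exact Or.inr (hBT x y z hxy hyz)
      · exact Or.inr (hTB x y z hxy hyz)
      · exact Or.inr (hTtrans x y z hxy hyz)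
  obtain ⟨B', htotal, hext⟩ := hU.exists_isExtension
  exact ⟨B', ⟨htotal, fun x y h => hext x y (Or.inl h)⟩, fun k i j hj hi =>
    hext j i (Or.inr ⟨k, j, i, Or.inl rfl, hj, hi, Or.inl rfl⟩)⟩

/-- Theorem 1: if all priorities are partial orders and `μ 1, …, μ K` are stable
matchings for `pr` linearly ranked by Pareto dominance, then there is an extension profile of
`pr` for which all of them are stable. -/
theorem exists_extension_profile_stabilizing_chain {I S : Type*} [Fintype I] [Fintype S]
    (hI : 3 ≤ Fintype.card I)
    (P : I → Option S → Option S → Prop) (hP : ∀ i, StrictPref (P i))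
    (q : S → ℕ) (hq : ∀ s, 1 ≤ q s)
    (pr : S → I → I → Prop) (hpr : ∀ s, PartialOrderRel (pr s))
    (K : ℕ) (hK : 1 ≤ K) (μ : Fin K → I → Option S)
    (hmatch : ∀ k, IsMatching q (μ k))
    (hstable : ∀ k, StableFor P q pr (μ k))
    (hdom : ∀ k k' : Fin K, k < k' → ParetoDominates P (μ k') (μ k)) :
    ∃ prstar : S → I → I → Prop,
      IsExtensionProfile pr prstar ∧ ∀ k, StableFor P q prstar (μ k) := by
  have hkey : ∀ s, ∃ B' : I → I → Prop, IsExtension (pr s) B' ∧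
      ∀ k i j, μ k j = some s → P i (some s) (μ k i) → B' j i := by
    intro s
    have hAE : ∀ k i, μ k i = some s → ¬ P i (some s) (μ k i) := by
      intro k i hi h
      rw [hi] at h
      exact (hP i).1 _ _ h h
    refine (hpr s).exists_isExtension_above (A := fun k j => μ k j = some s)
      (E := fun k i => P i (some s) (μ k i)) ?_ hAE ?_
    · intro k k' i hkk h
      rcases hkk.eq_or_lt with rfl | hlt
      · exact h
      · rcases (hdom k k' hlt).1 i with h' | h'
        · exact (hP i).2.1 h h'
        · exact h' ▸ h
    · exact fun k i j hj hi hij =>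
        (hstable k).2.2 ⟨i, j, s, hj, fun h => hAE k i h hi, Or.inl hi, hij⟩
  choose prstar hext habove using hkey
  refine ⟨prstar, hext, fun k => ⟨(hstable k).1, (hstable k).2.1, ?_⟩⟩
  rintro ⟨i, j, s, hj, hne, hR, hij⟩
  have hi : P i (some s) (μ k i) := hR.resolve_right fun h => hne h.symm
  exact (hext s).1.1.1.1 i j hij (habove s k i j hj hi)
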